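/- arXiv:2306.12238 — 3 statements merged into one kernel-verified Lean document; each statement's English description precedes it below -/
import Mathlib

section
/- Let U be a localisable f-algebra and let (u_n)_{n∈ℕ} be a sequence of idempotent elements of U. Then sup_{n∈ℕ} u_n and inf_{n∈ℕ} u_n exist in U and both are idempotent. -/
/-- An `f`-algebra: a Riesz space (real vector space with a lattice order, addition
order-preserving, nonnegative scalar multiples of nonnegative elements nonnegative) endowed
with an associative, commutative, distributive multiplication with identity `1`, compatible
with scalar multiplication, such that products of nonnegative elements are nonnegative and
the `f`-condition holds: `(a * c) ⊓ b = 0` whenever `a ⊓ b = 0` and `0 ≤ c`. -/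
class FAlgebra (A : Type*) extends Lattice A, CommRing A, Module ℝ A where
  add_le_add_left' : ∀ a b : A, a ≤ b → ∀ c : A, c + a ≤ c + b
  smul_nonneg' : ∀ (r : ℝ) (a : A), 0 ≤ r → 0 ≤ a → 0 ≤ r • a
  smul_mul' : ∀ (r : ℝ) (a b : A), r • (a * b) = (r • a) * b
  mul_nonneg' : ∀ a b : A, 0 ≤ a → 0 ≤ b → 0 ≤ a * b
  f_cond : ∀ a b c : A, a ⊓ b = 0 → 0 ≤ c → (a * c) ⊓ b = 0

/-- A family of elements of an `f`-algebra is pairwise disjoint if `|e i| ⊓ |e j| = 0`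
for all `i ≠ j`, where `|a| := a ⊔ -a`. -/
def PairwiseDisjointFam {A : Type*} [FAlgebra A] {ι : Type*} (e : ι → A) : Prop :=
  ∀ i j, i ≠ j → ((e i) ⊔ -(e i)) ⊓ ((e j) ⊔ -(e j)) = 0

/-- A simple element of an `f`-algebra: a finite real linear combination `∑ c i • e i`
where `(e i)` is a finite partition of `1` (pairwise disjoint idempotents summing to `1`). -/
def IsSimpleElem {A : Type*} [FAlgebra A] (a : A) : Prop :=
  ∃ (n : ℕ) (c : Fin n → ℝ) (e : Fin n → A),
    (∀ i, e i * e i = e i) ∧ PairwiseDisjointFam e ∧ (∑ i, e i) = 1 ∧ a = ∑ i, c i • e i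

/-- A localisable `f`-algebra: Dedekind σ-complete, with multiplication σ-order-continuous
on pairs of nonnegative elements, in which the simple elements are super-order-dense. -/
structure IsLocalisable (A : Type*) [FAlgebra A] : Prop where
  lub : ∀ S : Set A, S.Nonempty → S.Countable → BddAbove S → ∃ a, IsLUB S a
  glb : ∀ S : Set A, S.Nonempty → S.Countable → BddBelow S → ∃ a, IsGLB S a
  mul_scont : ∀ (a b : ℕ → A) (x y : A), (∀ n, 0 ≤ a n) → (∀ n, 0 ≤ b n) →
    Monotone a → Monotone b → IsLUB (Set.range a) x → IsLUB (Set.range b) y →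
    IsLUB (Set.range fun n => a n * b n) (x * y)
  simple_dense : ∀ x : A, 0 ≤ x → ∃ s : ℕ → A, Monotone s ∧ (∀ n, 0 ≤ s n) ∧
    (∀ n, IsSimpleElem (s n)) ∧ IsLUB (Set.range s) x

namespace FAlgebra

variable {A : Type*} [FAlgebra A]

instance : IsOrderedAddMonoid A where
  add_le_add_left a b h c := by
    simpa only [add_comm] using FAlgebra.add_le_add_left' a b h c

/-- Disjoint elements of an `f`-algebra have product zero. -/
theorem mul_eq_zero_of_inf_eq_zero {a b : A} (h : a ⊓ b = 0) : a * b = 0 := by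
  have ha : 0 ≤ a := h ▸ inf_le_left
  have hb : 0 ≤ b := h ▸ inf_le_right
  have h₁ : b ⊓ (a * b) = 0 := by rw [inf_comm]; exact FAlgebra.f_cond a b b h hb
  have h₂ := FAlgebra.f_cond b (a * b) a h₁ ha
  rwa [mul_comm b a, inf_idem] at h₂

/-- Squares are nonnegative in an `f`-algebra. -/
theorem mul_self_nonneg (a : A) : 0 ≤ a * a := by
  have hz : a⁺ * a⁻ = 0 := mul_eq_zero_of_inf_eq_zero (posPart_inf_negPart_eq_zero a)
  have hsq : a * a = a⁺ * a⁺ + a⁻ * a⁻ := by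
    calc a * a = (a⁺ - a⁻) * (a⁺ - a⁻) := by rw [posPart_sub_negPart]
      _ = a⁺ * a⁺ + a⁻ * a⁻ := by linear_combination (-2) * hz
  rw [hsq]
  exact add_nonneg (FAlgebra.mul_nonneg' _ _ (posPart_nonneg a) (posPart_nonneg a))
    (FAlgebra.mul_nonneg' _ _ (negPart_nonneg a) (negPart_nonneg a))

theorem nonneg_of_isIdempotentElem {a : A} (ha : IsIdempotentElem a) : 0 ≤ a :=
  ha.eq ▸ mul_self_nonneg a

theorem le_one_of_isIdempotentElem {a : A} (ha : IsIdempotentElem a) : a ≤ 1 :=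
  sub_nonneg.1 (nonneg_of_isIdempotentElem ha.one_sub)

/-- The supremum of two idempotents is `a + b - a * b`. -/
theorem isLUB_pair_of_isIdempotentElem {a b : A} (ha : IsIdempotentElem a)
    (hb : IsIdempotentElem b) : IsLUB {a, b} (a + b - a * b) := by
  have ha₀ := nonneg_of_isIdempotentElem ha
  have hb₀ := nonneg_of_isIdempotentElem hb
  have ha₁ := sub_nonneg.2 (le_one_of_isIdempotentElem ha)
  have hb₁ := sub_nonneg.2 (le_one_of_isIdempotentElem hb)
  constructor
  · rintro x (rfl | rfl)
    · rw [← sub_nonneg]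
      convert FAlgebra.mul_nonneg' _ _ hb₀ ha₁ using 1
      ring
    · rw [← sub_nonneg]
      convert FAlgebra.mul_nonneg' _ _ ha₀ hb₁ using 1
      ring
  · intro w hw
    have hwa : 0 ≤ w - a := sub_nonneg.2 (hw (by simp))
    have hwb : 0 ≤ w - b := sub_nonneg.2 (hw (by simp))
    rw [← sub_nonneg]
    convert add_nonneg (FAlgebra.mul_nonneg' _ _ ha₀ hwa)
      (FAlgebra.mul_nonneg' _ _ ha₁ hwb) using 1
    linear_combination ha.eq

theorem isIdempotentElem_sup {a b : A} (ha : IsIdempotentElem a)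
    (hb : IsIdempotentElem b) : IsIdempotentElem (a ⊔ b) := by
  rw [← (isLUB_pair_of_isIdempotentElem ha hb).unique isLUB_pair]
  exact ha.add_sub_mul hb

theorem isIdempotentElem_partialSups {u : ℕ → A} (hu : ∀ n, IsIdempotentElem (u n)) (n : ℕ) :
    IsIdempotentElem (partialSups u n) := by
  induction n with
  | zero => simpa using hu 0
  | succ n ih =>
    rw [partialSups_add_one]
    exact isIdempotentElem_sup ih (hu _)

theorem exists_isLUB_isIdempotentElem (hA : IsLocalisable A) {u : ℕ → A}
    (hu : ∀ n, IsIdempotentElem (u n)) :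
    ∃ s, IsLUB (Set.range u) s ∧ IsIdempotentElem s := by
  obtain ⟨s, hs⟩ := hA.lub (Set.range u) (Set.range_nonempty u) (Set.countable_range u)
    ⟨1, Set.forall_mem_range.2 fun n => le_one_of_isIdempotentElem (hu n)⟩
  have hp := isIdempotentElem_partialSups hu
  have hs' : IsLUB (Set.range (partialSups u)) s := by
    rwa [IsLUB, upperBounds_range_partialSups]
  have hp₀ := fun n => nonneg_of_isIdempotentElem (hp n)
  have hmul := hA.mul_scont _ _ s s hp₀ hp₀ (partialSups u).monotone (partialSups u).monotone
    hs' hs'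
  simp only [(hp _).eq] at hmul
  exact ⟨s, hs, hmul.unique hs'⟩

theorem exists_isGLB_isIdempotentElem (hA : IsLocalisable A) {u : ℕ → A}
    (hu : ∀ n, IsIdempotentElem (u n)) :
    ∃ t, IsGLB (Set.range u) t ∧ IsIdempotentElem t := by
  obtain ⟨s, hs, hss⟩ := exists_isLUB_isIdempotentElem hA fun n => (hu n).one_sub
  refine ⟨1 - s, ⟨?_, fun w hw => ?_⟩, hss.one_sub⟩
  · rintro _ ⟨n, rfl⟩
    exact sub_le_comm.1 (hs.1 ⟨n, rfl⟩)
  · refine le_sub_comm.1 (hs.2 ?_)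
    rintro _ ⟨n, rfl⟩
    exact sub_le_sub_left (hw ⟨n, rfl⟩) 1

end FAlgebra

/-- in a localisable `f`-algebra, the supremum and the infimum of any
sequence of idempotent elements exist and are idempotent. -/
theorem sup_inf_idempotent {A : Type*} [FAlgebra A] (hA : IsLocalisable A)
    (u : ℕ → A) (hu : ∀ n, u n * u n = u n) :
    (∃ s, IsLUB (Set.range u) s ∧ s * s = s) ∧
      (∃ t, IsGLB (Set.range u) t ∧ t * t = t) := by
  exact ⟨FAlgebra.exists_isLUB_isIdempotentElem hA hu,
    FAlgebra.exists_isGLB_isIdempotentElem hA hu⟩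
end

section
/- Let (X, 𝒜, μ) be a σ-finite measure space. Then L⁰(μ) is countably representable: for every nonempty set S ⊆ L⁰(μ) having an upper bound there exist h ∈ L⁰(μ) and a sequence (f_n)_{n∈ℕ} of elements of S such that h is the least upper bound of S and h is also the least upper bound of {f_n : n ∈ ℕ}; dually, every nonempty subset of L⁰(μ) having a lower bound has a greatest lower bound which is the greatest lower bound of a countable subfamily of the given set. -/
open MeasureTheory
open Set Filter Topology
open scoped ENNReal Pointwise

/-- In a partial order in which bounded sequences have least upper bounds and which carries a
strictly monotone `ℝ≥0∞`-valued functional, the least upper bound of a nonempty bounded set exists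
and is attained along a sequence. -/
theorem exists_seq_isLUB_of_strictMono {α : Type*} [PartialOrder α] {Φ : α → ℝ≥0∞}
    (hΦ : StrictMono Φ) (hα : ∀ f : ℕ → α, BddAbove (range f) → ∃ h, IsLUB (range f) h)
    {S : Set α} (hS : S.Nonempty) (hb : BddAbove S) :
    ∃ (h : α) (f : ℕ → α), (∀ n, f n ∈ S) ∧ IsLUB S h ∧ IsLUB (range f) h := by
  have lub_of_mem (f : ℕ → α) (hf : ∀ n, f n ∈ S) : ∃ h, IsLUB (range f) h :=
    hα f (hb.mono (range_subset_iff.2 hf))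
  let T : Set α := {h | ∃ f : ℕ → α, (∀ n, f n ∈ S) ∧ IsLUB (range f) h}
  have hT : T.Nonempty := by
    obtain ⟨s, hs⟩ := hS
    obtain ⟨h, hh⟩ := lub_of_mem (fun _ ↦ s) fun _ ↦ hs
    exact ⟨h, _, fun _ ↦ hs, hh⟩
  obtain ⟨u, -, hu, huT⟩ := exists_seq_tendsto_sSup (hT.image Φ) (OrderTop.bddAbove _)
  choose g hgT hgu using huT
  choose f hfS hfg using hgT
  have hFS (n : ℕ) : f n.unpair.1 n.unpair.2 ∈ S := hfS _ _
  obtain ⟨h, hh⟩ := lub_of_mem (fun n ↦ f n.unpair.1 n.unpair.2) hFS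
  have hg_le (k : ℕ) : g k ≤ h := (hfg k).2 <| by
    rintro _ ⟨m, rfl⟩
    exact hh.1 ⟨Nat.pair k m, by simp⟩
  have hsup : sSup (Φ '' T) ≤ Φ h :=
    le_of_tendsto' hu fun k ↦ hgu k ▸ hΦ.monotone (hg_le k)
  refine ⟨h, _, hFS, ⟨fun s hs ↦ ?_, fun b hb ↦ hh.2 ?_⟩, hh⟩
  · let F : ℕ → α := fun n ↦ Nat.casesOn n s fun n ↦ f n.unpair.1 n.unpair.2
    have hF (n : ℕ) : F n ∈ S := by
      cases n with
      | zero => exact hs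
      | succ n => exact hFS n
    obtain ⟨h', hh'⟩ := lub_of_mem F hF
    have hle : h ≤ h' := hh.2 <| by
      rintro _ ⟨n, rfl⟩
      exact hh'.1 ⟨n + 1, rfl⟩
    have hΦle : Φ h' ≤ Φ h := (le_sSup (mem_image_of_mem Φ (show h' ∈ T from ⟨F, hF, hh'⟩))).trans hsup
    have heq : h = h' := hle.eq_of_not_lt fun hlt ↦ (hΦ hlt).not_ge hΦle
    exact heq ▸ hh'.1 ⟨0, rfl⟩
  · rintro _ ⟨n, rfl⟩
    exact hb (hFS n)

namespace MeasureTheory.AEEqFun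

variable {X : Type*} [MeasurableSpace X] {μ : Measure X}

/-- A sequence in `L⁰(μ)` which is bounded above has a least upper bound. -/
theorem exists_isLUB_range (f : ℕ → X →ₘ[μ] ℝ) (hf : BddAbove (range f)) :
    ∃ h, IsLUB (range f) h := by
  obtain ⟨g, hg⟩ := hf
  have hm : AEStronglyMeasurable (fun x ↦ ⨆ n, f n x) μ :=
    (AEMeasurable.iSup fun n ↦ (f n).aemeasurable).aestronglyMeasurable
  have hfg : ∀ᵐ x ∂μ, ∀ n, f n x ≤ g x :=
    ae_all_iff.2 fun n ↦ coeFn_le.2 (hg ⟨n, rfl⟩)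
  refine ⟨mk _ hm, ?_, fun b hb ↦ coeFn_le.1 ?_⟩
  · rintro _ ⟨n, rfl⟩
    refine coeFn_le.1 ?_
    filter_upwards [coeFn_mk _ hm, hfg] with x hx hxg
    rw [hx]
    exact le_ciSup ⟨g x, forall_mem_range.2 hxg⟩ n
  · have hfb : ∀ᵐ x ∂μ, ∀ n, f n x ≤ b x :=
      ae_all_iff.2 fun n ↦ coeFn_le.2 (hb ⟨n, rfl⟩)
    filter_upwards [coeFn_mk _ hm, hfb] with x hx hxb
    rw [hx]
    exact ciSup_le hxb

/-- For an s-finite measure, `L⁰(μ)` carries a strictly monotone functional, namely the integral of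
`π / 2 + arctan f` with respect to a finite measure equivalent to `μ`. -/
theorem exists_strictMono [SFinite μ] : ∃ Φ : (X →ₘ[μ] ℝ) → ℝ≥0∞, StrictMono Φ := by
  obtain ⟨ν, hν, hμν, hνμ⟩ := exists_isFiniteMeasure_absolutelyContinuous μ
  let φ : ℝ → ℝ≥0∞ := fun t ↦ ENNReal.ofReal (Real.pi / 2 + Real.arctan t)
  have hpos (t : ℝ) : 0 < Real.pi / 2 + Real.arctan t := by
    linarith [Real.neg_pi_div_two_lt_arctan t]
  have hφ : StrictMono φ := fun s t hst ↦
    (ENNReal.ofReal_lt_ofReal_iff (hpos t)).2 (by gcongr)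
  have hφ_meas : Measurable φ := by fun_prop
  have hφ_le (t : ℝ) : φ t ≤ ENNReal.ofReal Real.pi :=
    ENNReal.ofReal_le_ofReal (by linarith [Real.arctan_lt_pi_div_two t])
  refine ⟨fun f ↦ ∫⁻ x, φ (f x) ∂ν, fun f g hfg ↦ ?_⟩
  have hle : (fun x ↦ φ (f x)) ≤ᵐ[ν] fun x ↦ φ (g x) := by
    filter_upwards [hνμ.ae_le (coeFn_le.2 hfg.le)] with x hx using hφ.monotone hx
  have hfin : ∫⁻ x, φ (f x) ∂ν ≠ ∞ := by
    have hbound : ∫⁻ x, φ (f x) ∂ν ≤ ∫⁻ _, ENNReal.ofReal Real.pi ∂ν :=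
      by gcongr; exact hφ_le _
    refine ne_top_of_le_ne_top ?_ hbound
    rw [lintegral_const]
    exact ENNReal.mul_ne_top ENNReal.ofReal_ne_top (measure_ne_top ν univ)
  refine lt_of_not_ge fun hge ↦ hfg.ne (ext ?_)
  have heq := ae_eq_of_ae_le_of_lintegral_le hle hfin
    (hφ_meas.comp g.measurable).aemeasurable hge
  filter_upwards [hμν.ae_le heq] with x hx using hφ.injective hx

instance instIsOrderedAddMonoidReal : IsOrderedAddMonoid (X →ₘ[μ] ℝ) where
  add_le_add_left f g hfg k := by
    refine coeFn_le.1 ?_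
    filter_upwards [coeFn_le.2 hfg, coeFn_add f k, coeFn_add g k] with x hx hf hg
    simpa [hf, hg] using hx

end MeasureTheory.AEEqFun

/-- for a σ-finite measure space `(X, 𝒜, μ)`, the space `L⁰(μ)` of
μ-a.e. equivalence classes of measurable real functions (with the a.e. order) is countably
representable: every nonempty subset with an upper bound has a least upper bound which is
also the least upper bound of a countable subfamily, and dually for lower bounds. -/
theorem L0_countably_representable {X : Type*} [MeasurableSpace X]
    (μ : Measure X) [SigmaFinite μ] :
    (∀ S : Set (X →ₘ[μ] ℝ), S.Nonempty → BddAbove S →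
      ∃ (h : X →ₘ[μ] ℝ) (f : ℕ → X →ₘ[μ] ℝ),
        (∀ n, f n ∈ S) ∧ IsLUB S h ∧ IsLUB (Set.range f) h) ∧
    (∀ S : Set (X →ₘ[μ] ℝ), S.Nonempty → BddBelow S →
      ∃ (h : X →ₘ[μ] ℝ) (f : ℕ → X →ₘ[μ] ℝ),
        (∀ n, f n ∈ S) ∧ IsGLB S h ∧ IsGLB (Set.range f) h) := by
  obtain ⟨Φ, hΦ⟩ := AEEqFun.exists_strictMono (μ := μ)
  have key := fun (S : Set (X →ₘ[μ] ℝ)) (hS : S.Nonempty) (hb : BddAbove S) ↦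
    exists_seq_isLUB_of_strictMono hΦ AEEqFun.exists_isLUB_range hS hb
  refine ⟨key, fun S hS hb ↦ ?_⟩
  obtain ⟨h, f, hfS, hh, hf⟩ := key (-S) hS.neg hb.neg
  refine ⟨-h, fun n ↦ -f n, hfS, isLUB_neg.1 hh, isLUB_neg.1 ?_⟩
  have hrange : -range (fun n ↦ -f n) = range f := by
    rw [← image_neg_eq_neg, ← range_comp]
    simp [Function.comp_def]
  rwa [hrange]
end

section
/- Pointwise Cauchy–Schwarz inequality for Hilbert modules: let U be an f-algebra, let H be a real vector space, and let |·| : H → U be a map such that for all v, w ∈ H and λ ∈ ℝ: |v| ≥ 0; |v + w| ≤ |v| + |w|; |λv| = |λ||v|; and the pointwise parallelogram rule |v + w|² + |v − w|² = 2|v|² + 2|w|² holds. Define the pointwise scalar product v·w := (1/4)(|v + w|² − |v − w|²) ∈ U. Then |v·w| ≤ |v||w| for all v, w ∈ H, where the outer |·| on the left-hand side denotes the absolute value x ⊔ (−x) in U. -/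
namespace FAlgebra

variable {A : Type*} [FAlgebra A]

instance inst_s17 : IsOrderedAddMonoid A where
  add_le_add_left a b h c := by
    rw [add_comm a c, add_comm b c]
    exact FAlgebra.add_le_add_left' a b h c

lemma sq_le_sq_of_nonneg {a b : A} (ha : 0 ≤ a) (hab : a ≤ b) : a ^ 2 ≤ b ^ 2 := by
  rw [← sub_nonneg, sq_sub_sq]
  exact FAlgebra.mul_nonneg' _ _ (add_nonneg (ha.trans hab) ha) (sub_nonneg.2 hab)

lemma quarter_smul_le {a b : A} (h : a ≤ 4 * b) : ((1 : ℝ) / 4) • a ≤ b := by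
  have hb : b = ((1 : ℝ) / 4) • (4 * b) := by
    rw [show (4 : A) * b = b + b + b + b by ring]
    module
  rw [← sub_nonneg]
  nth_rewrite 1 [hb]
  rw [← smul_sub]
  exact FAlgebra.smul_nonneg' _ _ (by norm_num) (sub_nonneg.2 h)

/-- If `s` and `d` are the norms of a sum and a difference, `a` and `b` those of the summands,
then the triangle inequality and the parallelogram rule bound the polarization. -/
lemma quarter_smul_sq_sub_sq_le {a b s d : A} (hs : 0 ≤ s) (htri : s ≤ a + b)
    (hpar : s ^ 2 + d ^ 2 = 2 * a ^ 2 + 2 * b ^ 2) :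
    ((1 : ℝ) / 4) • (s ^ 2 - d ^ 2) ≤ a * b := by
  apply quarter_smul_le
  have h := sub_nonneg.2 (sq_le_sq_of_nonneg hs htri)
  rw [← sub_nonneg]
  convert add_nonneg h h using 1
  linear_combination hpar

end FAlgebra

/-- pointwise Cauchy–Schwarz inequality for Hilbert modules: let `A` be an
`f`-algebra, `H` a real vector space, and `N : H → A` a pointwise norm satisfying
`0 ≤ N v`, `N (v + w) ≤ N v + N w`, `N (r • v) = |r| • N v`, and the pointwise
parallelogram rule `N(v+w)² + N(v-w)² = 2 N(v)² + 2 N(w)²`. With the pointwise scalar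
product `v·w := (1/4)(N(v+w)² − N(v−w)²)`, one has `|v·w| ≤ N v * N w`, where
`|a| := a ⊔ -a` in `A`. -/
theorem pointwise_cauchy_schwarz {A : Type*} [FAlgebra A]
    {H : Type*} [AddCommGroup H] [Module ℝ H] (N : H → A)
    (hnonneg : ∀ v, 0 ≤ N v)
    (htriangle : ∀ v w, N (v + w) ≤ N v + N w)
    (hhom : ∀ (r : ℝ) (v : H), N (r • v) = |r| • N v)
    (hpar : ∀ v w, N (v + w) ^ 2 + N (v - w) ^ 2 = 2 * N v ^ 2 + 2 * N w ^ 2)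
    (v w : H) (ip : A)
    (hip : ip = ((1 : ℝ) / 4) • (N (v + w) ^ 2 - N (v - w) ^ 2)) :
    ip ⊔ -ip ≤ N v * N w := by
  have hneg : N (-w) = N w := by simpa using hhom (-1) w
  have hsub : N (v - w) ≤ N v + N w := by
    simpa [sub_eq_add_neg, hneg] using htriangle v (-w)
  subst hip
  refine sup_le (FAlgebra.quarter_smul_sq_sub_sq_le (hnonneg _) (htriangle v w) (hpar v w)) ?_
  rw [← smul_neg, neg_sub]
  exact FAlgebra.quarter_smul_sq_sub_sq_le (hnonneg _) hsub ((add_comm _ _).trans (hpar v w))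
end
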